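/- arXiv:2406.04672 — 8 statements merged into one kernel-verified Lean document; each statement's English description precedes it below -/
import Mathlib

section
/- Let (S,•) be a partial semigroup. The following are equivalent: (a) S is a partial group, i.e. there is a left identity e (an idempotent with e ∈ L(s) and e•s = s for all s ∈ S) such that every x ∈ S has some y ∈ L(x) with y•x = e; (b) there is a two-sided identity e for S (e ∈ L(x) ∩ R(x), e•x = x•e = x for all x ∈ S) with the property that for each x ∈ S there is some y ∈ R(x) ∩ L(x) with x•y = y•x = e; (c) there is a left identity for S, and given any left identity e for S and any x ∈ S there is some y ∈ L(x) with y•x = e. -/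
/-- A partial semigroup: `op x y = some z` means `x • y` is defined and equals `z`. -/
def StrongAssoc {S : Type*} (op : S → S → Option S) : Prop :=
  ∀ x y z : S, (op x y).bind (fun w => op w z) = (op y z).bind (fun w => op x w)

/-- A partial group: there is a left identity `e` (an idempotent with `e ∈ L(s)` and
`e • s = s` for every `s`) such that every `x` has a left `e`-inverse `y ∈ L(x)`. -/
def IsPartialGroup {S : Type*} (op : S → S → Option S) : Prop :=
  ∃ e : S, op e e = some e ∧ (∀ s : S, op e s = some s) ∧
    ∀ x : S, ∃ y : S, op y x = some e

/-- equivalence of (a) partial group, (b) two-sided identity with two-sided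
inverses, (c) existence of a left identity and left inverses with respect to any left identity. -/
theorem stmt_3 {S : Type*} (op : S → S → Option S) (hassoc : StrongAssoc op) :
    (IsPartialGroup op ↔
      ∃ e : S, (∀ x : S, op e x = some x ∧ op x e = some x) ∧
        ∀ x : S, ∃ y : S, op x y = some e ∧ op y x = some e) ∧
    (IsPartialGroup op ↔
      ((∃ e : S, ∀ s : S, op e s = some s) ∧
        ∀ e : S, (∀ s : S, op e s = some s) → ∀ x : S, ∃ y : S, op y x = some e)) := by
  have key : IsPartialGroup op →
      ∃ e : S, (∀ x : S, op e x = some x ∧ op x e = some x) ∧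
        ∀ x : S, ∃ y : S, op x y = some e ∧ op y x = some e := by
    rintro ⟨e, -, hl, hinv⟩
    have hr : ∀ x y, op y x = some e → op x y = some e := by
      intro x y hyx
      obtain ⟨z, hz⟩ := hinv y
      have h1 := hassoc y x y
      rw [hyx, Option.bind_some, hl] at h1
      obtain ⟨w, hw, hyw⟩ := Option.bind_eq_some_iff.1 h1.symm
      have h2 := hassoc z y w
      rw [hz, hyw, Option.bind_some, Option.bind_some, hl, hz] at h2
      rw [hw, h2]
    refine ⟨e, fun x => ⟨hl x, ?_⟩, fun x => ?_⟩
    · obtain ⟨y, hy⟩ := hinv x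
      have h := hassoc x y x
      rw [hr x y hy, hy, Option.bind_some, Option.bind_some, hl] at h
      exact h.symm
    · obtain ⟨y, hy⟩ := hinv x
      exact ⟨y, hr x y hy, hy⟩
  refine ⟨⟨key, ?_⟩, ⟨fun h => ?_, ?_⟩⟩
  · rintro ⟨e, he, hinv⟩
    exact ⟨e, (he e).1, fun s => (he s).1, fun x => (hinv x).imp fun _ h => h.2⟩
  · obtain ⟨e, he, hinv⟩ := key h
    refine ⟨⟨e, fun s => (he s).1⟩, fun f hf x => ?_⟩
    have hfe : f = e := Option.some.inj ((he f).2.symm.trans (hf e))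
    subst hfe
    exact (hinv x).imp fun _ h => h.2
  · rintro ⟨⟨e, he⟩, hinv⟩
    exact ⟨e, he e, he, hinv e he⟩
end

section
/- Let (S,•) be a partial semigroup. The following are equivalent: (a) S is a partial group, i.e. there is a left identity e (an idempotent with e ∈ L(s) and e•s = s for all s ∈ S) such that every x ∈ S has some y ∈ L(x) with y•x = e; (b) there is a right identity e for S (e ∈ R(x) and x•e = x for all x ∈ S) such that for each x ∈ S there is some y ∈ R(x) with x•y = e; (c) there is a right identity for S, and given any right identity e for S and any x ∈ S there is some y ∈ R(x) with x•y = e. -/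
theorem aux_left_right {S : Type*} (op : S → S → Option S) (hassoc : StrongAssoc op) (e : S)
    (he : ∀ s : S, op e s = some s) (hi : ∀ x : S, ∃ y : S, op y x = some e) :
    (∀ x : S, op x e = some x) ∧ ∀ x : S, ∃ y : S, op x y = some e := by
  have key : ∀ x y : S, op y x = some e → op x y = some e := by
    intro x y hy
    obtain ⟨z, hz⟩ := hi y
    have h1 := hassoc z y x
    simp only [hz, hy, Option.bind_some, he] at h1
    have h2 := hassoc z e y
    simp only [← h1, he, Option.bind_some, hz] at h2
    exact h2
  refine ⟨fun x => ?_, fun x => ?_⟩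
  · obtain ⟨y, hy⟩ := hi x
    have h := hassoc x y x
    simp only [key x y hy, hy, Option.bind_some, he] at h
    exact h.symm
  · obtain ⟨y, hy⟩ := hi x
    exact ⟨y, key x y hy⟩

/-- equivalence of (a) partial group, (b) right identity with right inverses,
(c) existence of a right identity and right inverses with respect to any right identity. -/
theorem stmt_4 {S : Type*} (op : S → S → Option S) (hassoc : StrongAssoc op) :
    (IsPartialGroup op ↔
      ∃ e : S, (∀ x : S, op x e = some x) ∧ ∀ x : S, ∃ y : S, op x y = some e) ∧
    (IsPartialGroup op ↔
      ((∃ e : S, ∀ x : S, op x e = some x) ∧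
        ∀ e : S, (∀ x : S, op x e = some x) → ∀ x : S, ∃ y : S, op x y = some e)) := by
  have ab : IsPartialGroup op →
      ∃ e : S, (∀ x : S, op x e = some x) ∧ ∀ x : S, ∃ y : S, op x y = some e := by
    rintro ⟨e, -, he, hi⟩
    exact ⟨e, aux_left_right op hassoc e he hi⟩
  have ba : (∃ e : S, (∀ x : S, op x e = some x) ∧ ∀ x : S, ∃ y : S, op x y = some e) →
      IsPartialGroup op := by
    rintro ⟨e, he, hi⟩
    have h := aux_left_right (fun a b => op b a) (fun x y z => (hassoc z y x).symm) e he hi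
    exact ⟨e, he e, h.1, h.2⟩
  refine ⟨⟨ab, ba⟩, ⟨?_, ?_⟩⟩
  · rintro ⟨e, -, he, hi⟩
    have h := aux_left_right op hassoc e he hi
    refine ⟨⟨e, h.1⟩, fun f hf => ?_⟩
    have hfe : f = e := by
      have h1 := hf e
      rw [he f] at h1
      exact Option.some.inj h1
    rw [hfe]
    exact h.2
  · rintro ⟨⟨e, he⟩, h⟩
    exact ba ⟨e, he, h e he⟩
end

section
/- Let S be a partial semigroup with a left identity e (e ∈ L(x) and e•x = x for all x ∈ S) such that for each x ∈ S there is some y ∈ R(x) with x•y = e. Let Y = E(S), G = S•e = {s•e : s ∈ L(e)}, and D = {(g,y) ∈ G × Y : g•y is defined}. Then the map φ : D → S defined by φ(g,y) = g•y is a bijection from D onto S (in particular S = G•Y), and φ is a partial homomorphism: whenever (g₁,y₁), (g₂,y₂) ∈ D and φ(g₁,y₁)•φ(g₂,y₂) is defined, the products g₁•g₂ and y₁•y₂ are defined, (g₁•g₂, y₁•y₂) ∈ D, and φ(g₁,y₁)•φ(g₂,y₂) = φ(g₁•g₂, y₁•y₂). -/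
/-- The set of idempotents `E(S)`. -/
def Idem {S : Type*} (op : S → S → Option S) : Set S := {x | op x x = some x}

/-- `G = S•e`. -/
def Gset {S : Type*} (op : S → S → Option S) (e : S) : Set S := {w | ∃ s, op s e = some w}

/-- with `Y = E(S)`, `G = S•e`, `D = {(g,y) ∈ G × Y : g•y defined}`, the map
`φ(g,y) = g•y` is a bijection from `D` onto `S`, and it is a partial homomorphism. -/
theorem stmt_7 {S : Type*} (op : S → S → Option S) (hassoc : StrongAssoc op)
    (e : S) (hid : ∀ x : S, op e x = some x)
    (hinv : ∀ x : S, ∃ y : S, op x y = some e) :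
    (∀ s : S, ∃! p : S × S, p.1 ∈ Gset op e ∧ p.2 ∈ Idem op ∧ op p.1 p.2 = some s) ∧
    (∀ g₁ y₁ g₂ y₂ s₁ s₂ w : S,
      g₁ ∈ Gset op e → y₁ ∈ Idem op → op g₁ y₁ = some s₁ →
      g₂ ∈ Gset op e → y₂ ∈ Idem op → op g₂ y₂ = some s₂ →
      op s₁ s₂ = some w →
      ∃ g₃ y₃ : S, op g₁ g₂ = some g₃ ∧ op y₁ y₂ = some y₃ ∧
        g₃ ∈ Gset op e ∧ y₃ ∈ Idem op ∧ op g₃ y₃ = some w) := by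
  have hA : ∀ {x y z u v : S}, op x y = some u → op y z = some v → op u z = op x v := by
    intro x y z u v h1 h2
    have := hassoc x y z
    simpa [h1, h2] using this
  have htot : ∀ x z, ∃ w, op x z = some w := by
    intro x z
    obtain ⟨y, hy⟩ := hinv x
    obtain ⟨t, ht⟩ := hinv y
    have hxe : op x e = some t := by rw [← hA hy ht, hid]
    have h1 : op t z = op x z := hA hxe (hid z)
    have h2 := hassoc y t z
    rw [ht, Option.bind_some, hid] at h2
    cases h3 : op t z with
    | none => rw [h3] at h2; simp at h2
    | some w => exact ⟨w, by rw [← h1, h3]⟩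
  choose m hm using htot
  have ma : ∀ x y z, m (m x y) z = m x (m y z) := by
    intro x y z
    have := hA (hm x y) (hm y z)
    simpa [hm] using this
  simp only [Idem, Gset, Set.mem_setOf_eq, hm, Option.some.injEq] at *
  choose i hi using hinv
  have ide : ∀ x, m x x = x → m x e = e := by
    intro x hx
    rw [← hi x, ← ma, hx]
  have idl : ∀ x, m x x = x → ∀ z, m x z = z := by
    intro x hx z
    rw [← hid z, ← ma, ide x hx]
  have hid2 : ∀ s, m (m (i s) s) (m (i s) s) = m (i s) s := by
    intro s
    rw [ma, ← ma s, hi, hid]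
  refine ⟨fun s => ⟨(m s e, m (i s) s), ⟨⟨s, rfl⟩, hid2 s, ?_⟩, ?_⟩, ?_⟩
  · change m (m s e) (m (i s) s) = s
    rw [ma, hid, ← ma, hi, hid]
  · rintro ⟨g, y⟩ ⟨⟨a, ha⟩, hy, hs⟩
    dsimp only at ha hy hs
    have hg : m s e = g := by
      rw [← hs, ma, ide y hy, ← ha, ma, hid]
    have hy2 : m (i s) s = y := by
      have h1 : m (i s) g = e := by rw [← hg, ← ma, ide _ (hid2 s)]
      have h2 : m (i s) (m g y) = y := by rw [← ma, h1, hid]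
      rwa [hs] at h2
    rw [hg, hy2]
  · rintro g₁ y₁ g₂ y₂ s₁ s₂ w ⟨a, ha⟩ h1 hs1 ⟨b, hb⟩ h2 hs2 hw
    refine ⟨m g₁ g₂, y₂, rfl, idl y₁ h1 y₂, ⟨m g₁ b, ?_⟩, h2, ?_⟩
    · rw [ma, hb]
    · rw [← hw, ← hs1, ← hs2, ma, ma, idl y₁ h1]
end

section
/- Let S be a partial semigroup and suppose L is a minimal left ideal of S containing an idempotent e, and that L ∩ L(x) ≠ ∅ for every x ∈ L (so that L•x := {s•x : s ∈ L ∩ L(x)} is a nonempty left ideal contained in L). Then G := e•L•e = {(e•x)•e : x ∈ L, the products being defined} is a partial group with two-sided identity e: e•g = g•e = g for every g ∈ G, G is closed under the partial operation, and for every x ∈ G there exists y ∈ G ∩ L(x) with y•x = e. -/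
def IsLeftIdeal {S : Type*} (op : S → S → Option S) (I : Set S) : Prop :=
  I.Nonempty ∧ ∀ x ∈ I, ∀ y z : S, op y x = some z → z ∈ I

def IsMinimalLeftIdeal {S : Type*} (op : S → S → Option S) (L : Set S) : Prop :=
  IsLeftIdeal op L ∧ ∀ J : Set S, IsLeftIdeal op J → J ⊆ L → J = L

/-- `e•L•e = {(e•x)•e : x ∈ L, the products being defined}`. -/
def eLe {S : Type*} (op : S → S → Option S) (e : S) (L : Set S) : Set S :=
  {w | ∃ x ∈ L, ∃ v, op e x = some v ∧ op v e = some w}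

theorem assoc_right {S : Type*} {op : S → S → Option S} (h : StrongAssoc op) {x y z a b : S}
    (h1 : op x y = some a) (h2 : op a z = some b) : ∃ c, op y z = some c ∧ op x c = some b := by
  have := h x y z
  rw [h1, Option.bind_some, h2] at this
  exact Option.bind_eq_some_iff.mp this.symm

theorem assoc_left {S : Type*} {op : S → S → Option S} (h : StrongAssoc op) {x y z c b : S}
    (h1 : op y z = some c) (h2 : op x c = some b) : ∃ a, op x y = some a ∧ op a z = some b := by
  have := h x y z
  rw [h1, Option.bind_some, h2] at this
  exact Option.bind_eq_some_iff.mp this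

/-- if `L` is a minimal left ideal containing an idempotent `e`, and
`L ∩ L(x) ≠ ∅` for every `x ∈ L`, then `G = e•L•e` is a partial group with two-sided
identity `e`. -/
theorem stmt_8 {S : Type*} (op : S → S → Option S) (hassoc : StrongAssoc op)
    (L : Set S) (hL : IsMinimalLeftIdeal op L)
    (e : S) (heL : e ∈ L) (he : op e e = some e)
    (hLL : ∀ x ∈ L, ∃ s ∈ L, (op s x).isSome) :
    (∀ g ∈ eLe op e L, op e g = some g ∧ op g e = some g) ∧
    (∀ g₁ ∈ eLe op e L, ∀ g₂ ∈ eLe op e L, ∀ w, op g₁ g₂ = some w → w ∈ eLe op e L) ∧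
    (∀ x ∈ eLe op e L, ∃ y ∈ eLe op e L, op y x = some e) := by
  have hid : ∀ g ∈ eLe op e L, op e g = some g ∧ op g e = some g := by
    rintro g ⟨x, -, v, hv, hg⟩
    constructor
    · obtain ⟨c, hc, hec⟩ := assoc_right hassoc he hv
      obtain rfl : v = c := by simpa [hv] using hc
      obtain ⟨c, hc, h⟩ := assoc_right hassoc hec hg
      obtain rfl : g = c := by simpa [hg] using hc
      exact h
    · obtain ⟨a, ha, h⟩ := assoc_left hassoc he hg
      obtain rfl : g = a := by simpa [hg] using ha
      exact h
  have hGL : ∀ g ∈ eLe op e L, g ∈ L := by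
    rintro g ⟨x, -, v, -, hg⟩
    exact hL.1.2 e heL v g hg
  refine ⟨hid, ?_, ?_⟩
  · intro g₁ h₁ g₂ h₂ w hw
    refine ⟨w, hL.1.2 g₂ (hGL g₂ h₂) g₁ w hw, w, ?_, ?_⟩
    · obtain ⟨c, hc, h⟩ := assoc_right hassoc (hid g₁ h₁).1 hw
      obtain rfl : w = c := by simpa [hw] using hc
      exact h
    · obtain ⟨a, ha, h⟩ := assoc_left hassoc (hid g₂ h₂).2 hw
      obtain rfl : w = a := by simpa [hw] using ha
      exact h
  · intro x hx
    have hxL := hGL x hx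
    have hJ : {w | ∃ s ∈ L, op s x = some w} = L := by
      apply hL.2
      · constructor
        · obtain ⟨s, hs, h⟩ := hLL x hxL
          obtain ⟨w, hw⟩ := Option.isSome_iff_exists.mp h
          exact ⟨w, s, hs, hw⟩
        · rintro w ⟨s, hs, hw⟩ y z hz
          obtain ⟨a, ha, h⟩ := assoc_left hassoc hw hz
          exact ⟨a, hL.1.2 s hs y a ha, h⟩
      · rintro w ⟨s, hs, hw⟩
        exact hL.1.2 x hxL s w hw
    obtain ⟨s, hs, hsx⟩ : e ∈ {w | ∃ s ∈ L, op s x = some w} := hJ.symm.subset heL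
    obtain ⟨t, ht, htx⟩ := assoc_left hassoc (hid x hx).1 hsx
    obtain ⟨y, hy, hyx⟩ := assoc_left hassoc htx he
    obtain ⟨t', ht', hte⟩ := assoc_left hassoc he ht
    obtain rfl : t = t' := by simpa [ht] using ht'
    obtain ⟨y', hy', hye⟩ := assoc_left hassoc hte hy
    obtain rfl : y = y' := by simpa [hy] using hy'
    exact ⟨y, ⟨t, hL.1.2 e heL s t ht, y, hy, hye⟩, hyx⟩
end

section
/- Let S be a partial semigroup, let L be a minimal left ideal of S, and let T ⊆ S be such that ⋂_{s∈L}(R(s) ∩ T) ≠ ∅. Then T is a minimal left ideal of S if and only if there is some a ∈ ⋂_{s∈L}(R(s) ∩ T) such that T = L•a := {s•a : s ∈ L}. -/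
/-- if `L` is a minimal left ideal and `⋂_{s∈L}(R(s) ∩ T) ≠ ∅`, then `T`
is a minimal left ideal iff `T = L•a` for some `a ∈ ⋂_{s∈L}(R(s) ∩ T)`. -/
theorem stmt_10 {S : Type*} (op : S → S → Option S) (hassoc : StrongAssoc op)
    (L : Set S) (hL : IsMinimalLeftIdeal op L) (T : Set S)
    (hne : (⋂ s ∈ L, ({t | (op s t).isSome} ∩ T)).Nonempty) :
    IsMinimalLeftIdeal op T ↔
      ∃ a ∈ ⋂ s ∈ L, ({t | (op s t).isSome} ∩ T),
        T = {w | ∃ s ∈ L, op s a = some w} := by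
  have hideal : ∀ a ∈ ⋂ s ∈ L, ({t | (op s t).isSome} ∩ T),
      IsLeftIdeal op {w | ∃ s ∈ L, op s a = some w} := by
    intro a ha
    simp only [Set.mem_iInter] at ha
    refine ⟨?_, ?_⟩
    · obtain ⟨s, hs⟩ := hL.1.1
      obtain ⟨w, hw⟩ := Option.isSome_iff_exists.1 (ha s hs).1
      exact ⟨w, s, hs, hw⟩
    · rintro w ⟨s, hs, hw⟩ y z hz
      have h := hassoc y s a
      rw [hw, Option.bind_some, hz, Option.bind_eq_some_iff] at h
      obtain ⟨v, hv, hva⟩ := h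
      exact ⟨v, hL.1.2 s hs y v hv, hva⟩
  constructor
  · intro hT
    obtain ⟨a, ha⟩ := hne
    refine ⟨a, ha, ?_⟩
    refine (hT.2 _ (hideal a ha) ?_).symm
    rintro w ⟨s, hs, hw⟩
    simp only [Set.mem_iInter] at ha
    exact hT.1.2 a (ha s hs).2 s w hw
  · rintro ⟨a, ha, hTa⟩
    refine ⟨hTa ▸ hideal a ha, ?_⟩
    intro J hJ hJT
    simp only [Set.mem_iInter] at ha
    have hK : {s | s ∈ L ∧ ∃ w ∈ J, op s a = some w} = L := by
      apply hL.2
      · refine ⟨?_, ?_⟩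
        · obtain ⟨w, hw⟩ := hJ.1
          have hw' := hJT hw
          rw [hTa] at hw'
          obtain ⟨s, hs, hsw⟩ := hw'
          exact ⟨s, hs, w, hw, hsw⟩
        · rintro x ⟨hx, w, hw, hxw⟩ y z hz
          have hzL := hL.1.2 x hx y z hz
          obtain ⟨v, hv⟩ := Option.isSome_iff_exists.1 (ha z hzL).1
          have h := hassoc y x a
          rw [hz, hxw, Option.bind_some, Option.bind_some, hv] at h
          exact ⟨hzL, v, hJ.2 w hw y v h.symm, hv⟩
      · exact fun s hs => hs.1
    refine Set.Subset.antisymm hJT ?_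
    intro t ht
    rw [hTa] at ht
    obtain ⟨s, hs, hst⟩ := ht
    rw [← hK] at hs
    obtain ⟨_, w, hw, hsw⟩ := hs
    rw [hst] at hsw
    cases hsw
    exact hw
end

section
/- Let S be an adequate partial semigroup (R(H) := ⋂_{s∈H} R(s) ≠ ∅ and L(H) := ⋂_{s∈H} L(s) ≠ ∅ for every finite nonempty H ⊆ S) which has at least one minimal left ideal, and assume that for every minimal left ideal L of S, every x ∈ L and every s ∈ R(x), one has ⋂_{t∈L}(R(t) ∩ L•s) ≠ ∅. Then K(S) := ⋃{L : L is a minimal left ideal of S} is an ideal of S. -/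
def IsRightIdeal {S : Type*} (op : S → S → Option S) (I : Set S) : Prop :=
  I.Nonempty ∧ ∀ x ∈ I, ∀ y z : S, op x y = some z → z ∈ I

def IsIdeal {S : Type*} (op : S → S → Option S) (I : Set S) : Prop :=
  IsLeftIdeal op I ∧ IsRightIdeal op I

/-- `S` is adequate: `R(H)` and `L(H)` are nonempty for every finite nonempty `H ⊆ S`. -/
def Adequate {S : Type*} (op : S → S → Option S) : Prop :=
  ∀ H : Finset S, H.Nonempty →
    {a | ∀ s ∈ H, (op s a).isSome}.Nonempty ∧ {a | ∀ s ∈ H, (op a s).isSome}.Nonempty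

/-- if an adequate partial semigroup has a minimal left ideal, and for every
minimal left ideal `L`, each `x ∈ L` and `s ∈ R(x)` satisfy
`⋂_{t∈L}(R(t) ∩ L•s) ≠ ∅`, then `K(S)`, the union of all minimal left ideals, is an
ideal of `S`. -/
theorem stmt_12 {S : Type*} (op : S → S → Option S) (hassoc : StrongAssoc op)
    (hadeq : Adequate op)
    (hex : ∃ L : Set S, IsMinimalLeftIdeal op L)
    (hyp : ∀ L : Set S, IsMinimalLeftIdeal op L → ∀ x ∈ L, ∀ s : S, (op x s).isSome →
      (⋂ t ∈ L, ({u | (op t u).isSome} ∩ {w | ∃ t' ∈ L, op t' s = some w})).Nonempty) :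
    IsIdeal op {x | ∃ L : Set S, IsMinimalLeftIdeal op L ∧ x ∈ L} := by
  obtain ⟨L₀, hL₀⟩ := hex
  obtain ⟨x₀, hx₀⟩ := hL₀.1.1
  refine ⟨⟨⟨x₀, L₀, hL₀, hx₀⟩, ?_⟩, ⟨x₀, L₀, hL₀, hx₀⟩, ?_⟩
  · rintro x ⟨L, hL, hx⟩ y z h
    exact ⟨L, hL, hL.1.2 x hx y z h⟩
  · rintro x ⟨L, hL, hx⟩ s z h
    refine ⟨{w | ∃ t ∈ L, op t s = some w}, ⟨⟨⟨z, x, hx, h⟩, ?_⟩, ?_⟩, x, hx, h⟩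
    · rintro w ⟨t, ht, hw⟩ y v hv
      have ha := hassoc y t s
      rw [hw, Option.bind_some, hv, Option.bind_eq_some_iff] at ha
      obtain ⟨u, hu, hus⟩ := ha
      exact ⟨u, hL.1.2 t ht y u hu, hus⟩
    · rintro J hJ hJs
      refine Set.Subset.antisymm hJs ?_
      rintro w ⟨t, ht, hw⟩
      obtain ⟨j, hj⟩ := hJ.1
      obtain ⟨t₀, ht₀, hj₀⟩ := hJs hj
      -- the left ideal `S • t₀` is contained in `L`, hence equal to it
      have hP : {u | ∃ y, op y t₀ = some u} = L := by
        apply hL.2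
        · refine ⟨?_, ?_⟩
          · obtain ⟨a, ha⟩ := (hadeq {t₀} (Finset.singleton_nonempty _)).2
            obtain ⟨u, hu⟩ := Option.isSome_iff_exists.1 (ha t₀ (Finset.mem_singleton_self _))
            exact ⟨u, a, hu⟩
          · rintro u ⟨y, hy⟩ y' v hv
            have ha := hassoc y' y t₀
            rw [hy, Option.bind_some, hv, Option.bind_eq_some_iff] at ha
            obtain ⟨q, _, hq⟩ := ha
            exact ⟨q, hq⟩
        · rintro u ⟨y, hy⟩
          exact hL.1.2 t₀ ht₀ y u hy
      rw [← hP] at ht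
      obtain ⟨y, hy⟩ := ht
      have ha := hassoc y t₀ s
      rw [hy, hj₀, Option.bind_some, Option.bind_some, hw] at ha
      exact hJ.2 j hj y w ha.symm
end

section
/- Let (S,•) be a right adequate partial semigroup and let 𝒜 ⊆ 𝒫(S) be a family of subsets of S with the finite intersection property such that for each A ∈ 𝒜 and each x ∈ A there exists B ∈ 𝒜 with B ⊆ R(x) and x•B ⊆ A (x•b ∈ A for all b ∈ B). Then there exists an ultrafilter on S containing every member of 𝒜, and for any two ultrafilters p, q on S each containing every member of 𝒜, and every A ∈ 𝒜, one has {x ∈ S : x⁻¹A ∈ q} ∈ p; i.e. ⋂_{A∈𝒜} Â is a partial subsemigroup of βS. -/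
/-- `S` is right adequate: `R(H) = ⋂_{s∈H} R(s)` is nonempty for every finite nonempty `H`. -/
def RightAdequate {S : Type*} (op : S → S → Option S) : Prop :=
  ∀ H : Finset S, H.Nonempty → {a | ∀ s ∈ H, (op s a).isSome}.Nonempty

/-- `a⁻¹A = {t ∈ R(a) : a•t ∈ A}`. -/
def invSet {S : Type*} (op : S → S → Option S) (a : S) (A : Set S) : Set S :=
  {t | ∃ w, op a t = some w ∧ w ∈ A}

/-- if `𝒜` has the finite intersection property and for each `A ∈ 𝒜` and
`x ∈ A` there is `B ∈ 𝒜` with `B ⊆ R(x)` and `x•B ⊆ A`, then some ultrafilter contains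
every member of `𝒜`, and `⋂_{A∈𝒜} Â` is a partial subsemigroup of `βS`: for all
ultrafilters `p, q` containing `𝒜` and all `A ∈ 𝒜`, `{x : x⁻¹A ∈ q} ∈ p`. -/
theorem stmt_13 {S : Type*} (op : S → S → Option S) (hassoc : StrongAssoc op)
    (hadeq : RightAdequate op) (𝒜 : Set (Set S))
    (hfip : ∀ F : Finset (Set S), ↑F ⊆ 𝒜 → (⋂₀ (F : Set (Set S))).Nonempty)
    (hsub : ∀ A ∈ 𝒜, ∀ x ∈ A, ∃ B ∈ 𝒜, B ⊆ {t | (op x t).isSome} ∧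
      ∀ b ∈ B, ∃ w, op x b = some w ∧ w ∈ A) :
    (∃ p : Ultrafilter S, ∀ A ∈ 𝒜, A ∈ p) ∧
    (∀ p q : Ultrafilter S, (∀ A ∈ 𝒜, A ∈ p) → (∀ A ∈ 𝒜, A ∈ q) →
      ∀ A ∈ 𝒜, {x | invSet op x A ∈ q} ∈ p) := by
  refine ⟨?_, ?_⟩
  · have hne : (Filter.generate 𝒜).NeBot := by
      rw [Filter.generate_neBot_iff]
      intro t ht hfin
      have h := hfip hfin.toFinset (by simpa using ht)
      simpa using h
    exact ⟨Ultrafilter.of (Filter.generate 𝒜), fun A hA =>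
      Ultrafilter.of_le (Filter.generate 𝒜) (Filter.mem_generate_of_mem hA)⟩
  · intro p q hp hq A hA
    refine Filter.mem_of_superset (hp A hA) ?_
    intro x hx
    obtain ⟨B, hB, -, h⟩ := hsub A hA x hx
    exact Filter.mem_of_superset (hq B hB) h
end

section
/- Let S be a partial semigroup, let x be an ultrafilter on S with L(x) := {s ∈ S : R(s) ∈ x} nonempty, and let p be an ultrafilter on S with L(x) ∈ p, so that the product p•x := {A ⊆ S : {s ∈ S : s⁻¹A ∈ x} ∈ p} is an ultrafilter. Then the set {p•x : p an ultrafilter with L(x) ∈ p} is a left ideal of βS: for every s ∈ S with R(s) ∈ p•x, one has R(s) ∈ p, the ultrafilter s•p := {A ⊆ S : s⁻¹A ∈ p} contains L(x), and s•(p•x) := {A ⊆ S : s⁻¹A ∈ p•x} equals (s•p)•x. -/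
/-- For an ultrafilter `x` on `S`, `L(x) = {s ∈ S : R(s) ∈ x}`. -/
def LofU {S : Type*} (op : S → S → Option S) (x : Ultrafilter S) : Set S :=
  {s | {t | (op s t).isSome} ∈ x}

theorem invSet_comp_aux {S : Type*} (op : S → S → Option S) (hassoc : StrongAssoc op)
    (s t w : S) (h : op s t = some w) (A : Set S) :
    invSet op t (invSet op s A) = invSet op w A := by
  ext u
  have h1 := hassoc s t u
  rw [h] at h1
  simp only [Option.bind_some] at h1
  simp only [invSet, Set.mem_setOf_eq]
  rw [h1]
  constructor
  · rintro ⟨v, hv, z, hz, hA⟩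
    exact ⟨z, by simp [hv, hz], hA⟩
  · rintro ⟨z, hz, hA⟩
    obtain ⟨v, hv, hvz⟩ := Option.bind_eq_some_iff.1 hz
    exact ⟨v, hv, z, hvz, hA⟩

theorem isSome_eq_invSet_aux {S : Type*} (op : S → S → Option S) (s : S) :
    {t | (op s t).isSome} = invSet op s Set.univ := by
  ext t
  simp [invSet, Option.isSome_iff_exists]

/-- with `x, p` ultrafilters, `L(x) ≠ ∅`, `L(x) ∈ p`, and `q = p•x`
(i.e. `A ∈ q ↔ {s : s⁻¹A ∈ x} ∈ p`), the set `{p•x : L(x) ∈ p}` is a left ideal of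
`βS`: for every `s ∈ S` with `R(s) ∈ p•x` one has `R(s) ∈ p`, the ultrafilter
`s•p = {A : s⁻¹A ∈ p}` contains `L(x)`, and `s•(p•x) = (s•p)•x`. -/
theorem stmt_15 {S : Type*} (op : S → S → Option S) (hassoc : StrongAssoc op)
    (x p : Ultrafilter S) (hne : (LofU op x).Nonempty) (hp : LofU op x ∈ p)
    (q : Ultrafilter S) (hq : ∀ A : Set S, A ∈ q ↔ {s | invSet op s A ∈ x} ∈ p) :
    ∀ s : S, {t | (op s t).isSome} ∈ q →
      ({t | (op s t).isSome} ∈ p ∧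
        ∃ sp : Ultrafilter S, (∀ A : Set S, A ∈ sp ↔ invSet op s A ∈ p) ∧
          LofU op x ∈ sp ∧
          ∀ A : Set S, invSet op s A ∈ q ↔ {t | invSet op t A ∈ x} ∈ sp) := by
  intro s hs
  have hs' := (hq _).1 hs
  have hR : {t | (op s t).isSome} ∈ p := by
    filter_upwards [hs'] with t ht
    obtain ⟨u, v, hv, hz⟩ := x.nonempty_of_mem ht
    have h1 := hassoc s t u
    simp only [Set.mem_setOf_eq] at hz ⊢
    rw [hv, Option.bind_some] at h1
    cases h : op s t with
    | none => rw [h, Option.bind_none] at h1; rw [← h1] at hz; simp at hz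
    | some w => rfl
  have hsp : ∀ A : Set S, A ∈ p.map (fun t => (op s t).getD s) ↔ invSet op s A ∈ p := by
    intro A
    rw [Ultrafilter.mem_map]
    constructor
    · intro h
      filter_upwards [h, hR] with t ht hd
      obtain ⟨w, hw⟩ := Option.isSome_iff_exists.1 hd
      exact ⟨w, hw, by simpa [hw] using ht⟩
    · intro h
      filter_upwards [h] with t ht
      obtain ⟨w, hw, hA⟩ := ht
      simpa [hw] using hA
  have key : ∀ A : Set S, invSet op s A ∈ q ↔
      {t | invSet op t A ∈ x} ∈ p.map (fun t => (op s t).getD s) := by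
    intro A
    rw [hsp, hq]
    constructor
    · intro h
      filter_upwards [h, hR] with t ht hd
      obtain ⟨w, hw⟩ := Option.isSome_iff_exists.1 hd
      refine ⟨w, hw, ?_⟩
      simp only [Set.mem_setOf_eq] at ht ⊢
      rwa [invSet_comp_aux op hassoc s t w hw] at ht
    · intro h
      filter_upwards [h] with t ht
      obtain ⟨w, hw, hA⟩ := ht
      simp only [Set.mem_setOf_eq] at hA ⊢
      rwa [invSet_comp_aux op hassoc s t w hw]
  refine ⟨hR, _, hsp, ?_, key⟩
  have h2 := (key Set.univ).1 (by rw [← isSome_eq_invSet_aux]; exact hs)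
  simpa only [LofU, isSome_eq_invSet_aux] using h2
end
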